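/- arXiv:1611.02993 — 2 statements merged into one kernel-verified Lean document; each statement's English description precedes it below -/
import Mathlib

section
/- In the second order setting, let x be the exact solution of A₂*A₂x = f, A₁*x = g, πx = k (with x ∈ D(A₁*) ∩ D(A₂) and A₂x ∈ D(A₂*)), let x̃ ∈ H₂ be arbitrary, and set e := x − x̃ and e_{A₂*} := π_{R(A₂*)}e. Then ‖e_{A₂*}‖²_{H₂} = min over ξ ∈ D(A₂*A₂) := {ξ ∈ D(A₂) : A₂ξ ∈ D(A₂*)} of ( c₂²‖A₂*A₂ξ − f‖_{H₂} + ‖ξ − x̃‖_{H₂} )² = max over φ ∈ D(A₂*A₂) of ( 2⟨f, φ⟩_{H₂} − ⟨2x̃ + A₂*A₂φ, A₂*A₂φ⟩_{H₂} ); the minimum is attained at ξ̂ := e_{A₂*} + x̃, which satisfies ξ̂ ∈ D(A₂*A₂), A₂ξ̂ = A₂x and A₂*A₂ξ̂ = f. -/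
open Submodule LinearPMap RealInnerProductSpace

noncomputable section

/-- The range of a partially defined linear operator, as a submodule. -/
def pRan {E F : Type*} [AddCommGroup E] [Module ℝ E] [AddCommGroup F] [Module ℝ F]
    (A : E →ₗ.[ℝ] F) : Submodule ℝ F :=
  LinearMap.range A.toFun

/-- The kernel of a partially defined linear operator, as a submodule of the ambient space. -/
def pKer {E F : Type*} [AddCommGroup E] [Module ℝ E] [AddCommGroup F] [Module ℝ F]
    (A : E →ₗ.[ℝ] F) : Submodule ℝ E :=
  (LinearMap.ker A.toFun).map A.domain.subtype

variable {H₁ H₂ H₃ : Type*}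
  [NormedAddCommGroup H₁] [InnerProductSpace ℝ H₁] [CompleteSpace H₁]
  [NormedAddCommGroup H₂] [InnerProductSpace ℝ H₂] [CompleteSpace H₂]
  [NormedAddCommGroup H₃] [InnerProductSpace ℝ H₃] [CompleteSpace H₃]

theorem mem_pRan {E F : Type*} [AddCommGroup E] [Module ℝ E] [AddCommGroup F] [Module ℝ F]
    {A : E →ₗ.[ℝ] F} {y : F} : y ∈ pRan A ↔ ∃ (u : E) (hu : u ∈ A.domain), A ⟨u, hu⟩ = y := by
  simp only [pRan, LinearMap.mem_range, Subtype.exists]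
  rfl

theorem mem_pKer {E F : Type*} [AddCommGroup E] [Module ℝ E] [AddCommGroup F] [Module ℝ F]
    {A : E →ₗ.[ℝ] F} {u : E} : u ∈ pKer A ↔ ∃ hu : u ∈ A.domain, A ⟨u, hu⟩ = 0 := by
  simp only [pKer, Submodule.mem_map, LinearMap.mem_ker, Subtype.exists]
  constructor
  · rintro ⟨v, hv, h, rfl⟩
    exact ⟨hv, h⟩
  · rintro ⟨hu, h⟩
    exact ⟨u, hu, h, rfl⟩

/-- A densely defined operator maps into the orthogonal complement of the kernel of its adjoint. -/
theorem apply_mem_pKer_adjoint_orthogonal {E F : Type*} [NormedAddCommGroup E]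
    [InnerProductSpace ℝ E] [CompleteSpace E] [NormedAddCommGroup F] [InnerProductSpace ℝ F]
    {A : E →ₗ.[ℝ] F} (hA : Dense (A.domain : Set E)) (v : A.domain) : A v ∈ (pKer (A†))ᗮ := by
  rw [mem_orthogonal]
  intro w hw
  obtain ⟨hw, hw0⟩ := mem_pKer.1 hw
  simpa [hw0] using (adjoint_isFormalAdjoint hA ⟨w, hw⟩ v).symm

/-- `R(A)ᗮ ≤ N(A†)`. -/
theorem pRan_orthogonal_le_pKer_adjoint {E F : Type*} [NormedAddCommGroup E]
    [InnerProductSpace ℝ E] [CompleteSpace E] [NormedAddCommGroup F] [InnerProductSpace ℝ F]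
    {A : E →ₗ.[ℝ] F} (hA : Dense (A.domain : Set E)) : (pRan A)ᗮ ≤ pKer (A†) := by
  intro w hw
  have hzero : ∀ v : A.domain, ⟪(0 : E), (v : E)⟫ = ⟪w, A v⟫ := fun v => by
    rw [inner_zero_left, real_inner_comm]
    exact ((mem_orthogonal _ _).1 hw _ (mem_pRan.2 ⟨v, v.2, rfl⟩)).symm
  have hw' : w ∈ A†.domain := mem_adjoint_domain_of_exists _ ⟨0, hzero⟩
  exact mem_pKer.2 ⟨hw', adjoint_apply_eq hA _ hzero⟩

/-- For a closed densely defined operator, `R(A†)ᗮ = N(A)`. -/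
theorem pRan_adjoint_orthogonal {A : H₂ →ₗ.[ℝ] H₃}
    (hA : Dense (A.domain : Set H₂)) (hc : A.IsClosed) : (pRan (A†))ᗮ = pKer A := by
  apply le_antisymm
  · intro u hu
    let L := WithLp.prodContinuousLinearEquiv 2 ℝ H₂ H₃
    let G : Submodule ℝ (WithLp 2 (H₂ × H₃)) := A.graph.comap L.toLinearEquiv.toLinearMap
    have hG : IsClosed (G : Set (WithLp 2 (H₂ × H₃))) := IsClosed.preimage L.continuous hc
    have : CompleteSpace G := hG.completeSpace_coe
    have huG : WithLp.toLp 2 (u, (0 : H₃)) ∈ G := by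
      rw [← G.orthogonal_orthogonal, mem_orthogonal]
      intro z hz
      have hz' : ∀ v : A.domain, ⟪-z.fst, (v : H₂)⟫ = ⟪z.snd, A v⟫ := fun v => by
        have h := (mem_orthogonal _ _).1 hz (WithLp.toLp 2 ((v : H₂), A v)) (A.mem_graph v)
        rw [WithLp.prod_inner_apply] at h
        change ⟪(v : H₂), z.fst⟫ + ⟪A v, z.snd⟫ = 0 at h
        rw [inner_neg_left, real_inner_comm, real_inner_comm (A v)]
        linarith
      have hzd : z.snd ∈ A†.domain := mem_adjoint_domain_of_exists _ ⟨_, hz'⟩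
      have h := (mem_orthogonal _ _).1 hu _
        (mem_pRan.2 ⟨z.snd, hzd, adjoint_apply_eq hA ⟨z.snd, hzd⟩ hz'⟩)
      rw [inner_neg_left, neg_eq_zero] at h
      rw [WithLp.prod_inner_apply]
      simpa using h
    obtain ⟨v, hv, hv0⟩ := A.mem_graph_iff.1 (show (u, (0 : H₃)) ∈ A.graph from huG)
    simp only at hv hv0
    subst hv
    exact mem_pKer.2 ⟨v.2, hv0⟩
  · intro u hu
    obtain ⟨hu, hu0⟩ := mem_pKer.1 hu
    rw [mem_orthogonal]
    intro y hy
    obtain ⟨w, hw, rfl⟩ := mem_pRan.1 hy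
    rw [adjoint_isFormalAdjoint hA ⟨w, hw⟩ ⟨u, hu⟩, hu0, inner_zero_right]

/-- If `R(A)` is closed, then `R(A†) ⊆ R(A†A)`. -/
theorem exists_adjoint_apply_apply_eq {A : H₂ →ₗ.[ℝ] H₃}
    (hA : Dense (A.domain : Set H₂)) (hr : IsClosed (pRan A : Set H₃)) {p : H₂}
    (hp : p ∈ pRan (A†)) :
    ∃ (φ : H₂) (hφ : φ ∈ A.domain) (hφφ : A ⟨φ, hφ⟩ ∈ A†.domain),
      A† ⟨A ⟨φ, hφ⟩, hφφ⟩ = p := by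
  obtain ⟨w, hw, rfl⟩ := mem_pRan.1 hp
  have : CompleteSpace (pRan A) := hr.completeSpace_coe
  obtain ⟨y, hy, z, hz, hyz⟩ := (pRan A).exists_add_mem_mem_orthogonal w
  obtain ⟨φ, hφ, rfl⟩ := mem_pRan.1 hy
  obtain ⟨hzd, hz0⟩ := mem_pKer.1 (pRan_orthogonal_le_pKer_adjoint hA hz)
  have hAφ : A ⟨φ, hφ⟩ = w - z := by rw [hyz, add_sub_cancel_right]
  have hφφ : A ⟨φ, hφ⟩ ∈ A†.domain := hAφ ▸ sub_mem hw hzd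
  refine ⟨φ, hφ, hφφ, ?_⟩
  have : (⟨A ⟨φ, hφ⟩, hφφ⟩ : A†.domain) = ⟨w, hw⟩ - ⟨z, hzd⟩ := Subtype.ext hAφ
  rw [this, LinearPMap.map_sub, hz0, sub_zero]

/-- The Friedrichs/Poincaré estimates for `A` and `A†` bound the pairing of an element of `R(A†)`
with `v ∈ D(A†A)` in terms of `A†A v`. -/
theorem inner_le_of_mem_pRan_adjoint {A : H₂ →ₗ.[ℝ] H₃}
    (hA : Dense (A.domain : Set H₂)) (hcl : A.IsClosed) {c : ℝ} (hc : 0 ≤ c)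
    (hcA : ∀ v : A.domain, (v : H₂) ∈ (pKer A)ᗮ → ‖(v : H₂)‖ ≤ c * ‖A v‖)
    (hcA' : ∀ w : (A†).domain, (w : H₃) ∈ (pKer (A†))ᗮ → ‖(w : H₃)‖ ≤ c * ‖A† w‖)
    {p : H₂} (hp : p ∈ pRan (A†)) (v : A.domain) (hv : A v ∈ A†.domain) :
    ⟪p, (v : H₂)⟫ ≤ ‖p‖ * (c ^ 2 * ‖A† ⟨A v, hv⟩‖) := by
  have hK := pRan_adjoint_orthogonal hA hcl
  have : CompleteSpace (pKer A) := by
    rw [← hK]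
    infer_instance
  obtain ⟨y, hy, z, hz, hyz⟩ := (pKer A).exists_add_mem_mem_orthogonal (v : H₂)
  have hpy : ⟪p, y⟫ = 0 := (mem_orthogonal _ _).1 (hK ▸ hy) p hp
  obtain ⟨hyd, hy0⟩ := mem_pKer.1 hy
  have hzv : z = v - y := by rw [hyz, add_sub_cancel_left]
  have hzd : z ∈ A.domain := hzv ▸ sub_mem v.2 hyd
  have hAz : A ⟨z, hzd⟩ = A v := by
    have : (⟨z, hzd⟩ : A.domain) = v - ⟨y, hyd⟩ := Subtype.ext hzv
    rw [this, LinearPMap.map_sub, hy0, sub_zero]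
  have hz_le : ‖z‖ ≤ c * ‖A v‖ := hAz ▸ hcA ⟨z, hzd⟩ hz
  have hAv_le : ‖A v‖ ≤ c * ‖A† ⟨A v, hv⟩‖ :=
    hcA' ⟨A v, hv⟩ (apply_mem_pKer_adjoint_orthogonal hA v)
  calc ⟪p, (v : H₂)⟫ = ⟪p, z⟫ := by rw [hyz, inner_add_right, hpy, zero_add]
    _ ≤ ‖p‖ * ‖z‖ := real_inner_le_norm _ _
    _ ≤ ‖p‖ * (c ^ 2 * ‖A† ⟨A v, hv⟩‖) := by
      gcongr
      calc ‖z‖ ≤ c * ‖A v‖ := hz_le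
        _ ≤ c * (c * ‖A† ⟨A v, hv⟩‖) := by gcongr
        _ = c ^ 2 * ‖A† ⟨A v, hv⟩‖ := by ring

/-- Second order a posteriori error estimate for the `R(A₂†)` part of the
error: let `x` solve `A₂†A₂ x = f`, `A₁† x = g`, `π x = k`, let `xt ∈ H₂` be arbitrary, and let
`e_{A₂†} = π_{R(A₂†)} (x - xt)`. Then
`‖e_{A₂†}‖² = min_{ξ ∈ D(A₂†A₂)} ( c₂²‖A₂†A₂ξ - f‖ + ‖ξ - xt‖ )²
            = max_{φ ∈ D(A₂†A₂)} ( 2⟪f, φ⟫ - ⟪2xt + A₂†A₂φ, A₂†A₂φ⟫ )`,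
the minimum being attained at `ξ̂ = e_{A₂†} + xt ∈ D(A₂†A₂)` with `A₂ ξ̂ = A₂ x` and
`A₂†A₂ ξ̂ = f`. -/
theorem statement18 (A₁ : H₁ →ₗ.[ℝ] H₂) (A₂ : H₂ →ₗ.[ℝ] H₃)
    (hdense₁ : Dense (A₁.domain : Set H₁)) (hdense₂ : Dense (A₂.domain : Set H₂))
    (hclosed₁ : A₁.IsClosed) (hclosed₂ : A₂.IsClosed)
    (hcomplex : pRan A₁ ≤ pKer A₂)
    (hrange₁ : IsClosed (pRan A₁ : Set H₂)) (hrange₂ : IsClosed (pRan A₂ : Set H₃))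
    (f : H₂) (g : H₁) (k : H₂)
    (hf : f ∈ pRan (A₂†)) (hg : g ∈ pRan (A₁†)) (hk : k ∈ pKer A₂ ⊓ pKer (A₁†))
    -- `x` is the exact solution of the second order system
    (x : H₂) (hx₂ : x ∈ A₂.domain) (hx₁ : x ∈ (A₁†).domain)
    (hxx : A₂ ⟨x, hx₂⟩ ∈ (A₂†).domain)
    (hxf : A₂† ⟨A₂ ⟨x, hx₂⟩, hxx⟩ = f) (hxg : A₁† ⟨x, hx₁⟩ = g)
    (hxk : x - k ∈ (pKer A₂ ⊓ pKer (A₁†))ᗮ)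
    -- `c₂` is the Friedrichs/Poincaré constant for `A₂` (and for `A₂†`)
    (c₂ : ℝ) (hc₂pos : 0 < c₂)
    (hc₂ : ∀ v : A₂.domain, (v : H₂) ∈ (pKer A₂)ᗮ → ‖(v : H₂)‖ ≤ c₂ * ‖A₂ v‖)
    (hc₂adj : ∀ w : (A₂†).domain, (w : H₃) ∈ (pKer (A₂†))ᗮ → ‖(w : H₃)‖ ≤ c₂ * ‖A₂† w‖)
    -- `xt` is an arbitrary approximation and `eA₂s = π_{R(A₂†)} (x - xt)`
    (xt : H₂) (eA₂s : H₂) (heA₂s : eA₂s ∈ pRan (A₂†))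
    (heA₂sperp : (x - xt) - eA₂s ∈ (pRan (A₂†))ᗮ) :
    -- the minimum characterization
    IsLeast {r : ℝ | ∃ (ξ : H₂) (hξ : ξ ∈ A₂.domain) (hξξ : A₂ ⟨ξ, hξ⟩ ∈ (A₂†).domain),
      r = (c₂ ^ 2 * ‖A₂† ⟨A₂ ⟨ξ, hξ⟩, hξξ⟩ - f‖ + ‖ξ - xt‖) ^ 2} (‖eA₂s‖ ^ 2)
    -- the maximum characterization
    ∧ IsGreatest {r : ℝ | ∃ (φ : H₂) (hφ : φ ∈ A₂.domain) (hφφ : A₂ ⟨φ, hφ⟩ ∈ (A₂†).domain),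
      r = 2 * ⟪f, φ⟫ - ⟪(2 : ℝ) • xt + A₂† ⟨A₂ ⟨φ, hφ⟩, hφφ⟩, A₂† ⟨A₂ ⟨φ, hφ⟩, hφφ⟩⟫}
      (‖eA₂s‖ ^ 2)
    -- the minimum is attained at `ξ̂ = e_{A₂†} + xt`
    ∧ ∃ (hξ : eA₂s + xt ∈ A₂.domain) (hξξ : A₂ ⟨eA₂s + xt, hξ⟩ ∈ (A₂†).domain),
        A₂ ⟨eA₂s + xt, hξ⟩ = A₂ ⟨x, hx₂⟩
        ∧ A₂† ⟨A₂ ⟨eA₂s + xt, hξ⟩, hξξ⟩ = f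
        ∧ (c₂ ^ 2 * ‖A₂† ⟨A₂ ⟨eA₂s + xt, hξ⟩, hξξ⟩ - f‖ + ‖(eA₂s + xt) - xt‖) ^ 2
          = ‖eA₂s‖ ^ 2 := by
  subst hxf
  set p := eA₂s
  have hpinner : ∀ q ∈ pRan (A₂†), ⟪q, x - xt⟫ = ⟪q, p⟫ := fun q hq => by
    have h := (mem_orthogonal _ _).1 heA₂sperp q hq
    rwa [inner_sub_right, sub_eq_zero] at h
  have hvalue : ∀ (φ : H₂) (hφ : φ ∈ A₂.domain) (hφφ : A₂ ⟨φ, hφ⟩ ∈ (A₂†).domain),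
      2 * ⟪A₂† ⟨A₂ ⟨x, hx₂⟩, hxx⟩, φ⟫
        - ⟪(2 : ℝ) • xt + A₂† ⟨A₂ ⟨φ, hφ⟩, hφφ⟩, A₂† ⟨A₂ ⟨φ, hφ⟩, hφφ⟩⟫
      = ‖p‖ ^ 2 - ‖p - A₂† ⟨A₂ ⟨φ, hφ⟩, hφφ⟩‖ ^ 2 := by
    intro φ hφ hφφ
    have hfφ : ⟪A₂† ⟨A₂ ⟨x, hx₂⟩, hxx⟩, φ⟫ = ⟪A₂† ⟨A₂ ⟨φ, hφ⟩, hφφ⟩, x⟫ := by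
      rw [adjoint_isFormalAdjoint hdense₂ ⟨A₂ ⟨x, hx₂⟩, hxx⟩ ⟨φ, hφ⟩,
        adjoint_isFormalAdjoint hdense₂ ⟨A₂ ⟨φ, hφ⟩, hφφ⟩ ⟨x, hx₂⟩]
      exact real_inner_comm _ _
    have hq := hpinner _ (mem_pRan.2 ⟨A₂ ⟨φ, hφ⟩, hφφ, rfl⟩)
    rw [hfφ, norm_sub_sq_real, inner_add_left, real_inner_smul_left,
      real_inner_self_eq_norm_sq, real_inner_comm _ p, ← hq, inner_sub_right,
      real_inner_comm _ xt]
    ring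
  have hattained : ∃ (hξ : p + xt ∈ A₂.domain) (hξξ : A₂ ⟨p + xt, hξ⟩ ∈ (A₂†).domain),
      A₂ ⟨p + xt, hξ⟩ = A₂ ⟨x, hx₂⟩
      ∧ A₂† ⟨A₂ ⟨p + xt, hξ⟩, hξξ⟩ = A₂† ⟨A₂ ⟨x, hx₂⟩, hxx⟩
      ∧ (c₂ ^ 2 * ‖A₂† ⟨A₂ ⟨p + xt, hξ⟩, hξξ⟩ - A₂† ⟨A₂ ⟨x, hx₂⟩, hxx⟩‖
          + ‖(p + xt) - xt‖) ^ 2 = ‖p‖ ^ 2 := by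
    rw [pRan_adjoint_orthogonal hdense₂ hclosed₂] at heA₂sperp
    obtain ⟨hd, h0⟩ := mem_pKer.1 heA₂sperp
    have hξx : p + xt = x - (x - xt - p) := by abel
    have hξ : p + xt ∈ A₂.domain := hξx ▸ sub_mem hx₂ hd
    have hAξ : A₂ ⟨p + xt, hξ⟩ = A₂ ⟨x, hx₂⟩ := by
      have : (⟨p + xt, hξ⟩ : A₂.domain) = ⟨x, hx₂⟩ - ⟨x - xt - p, hd⟩ := Subtype.ext hξx
      rw [this, LinearPMap.map_sub, h0, sub_zero]
    have hξξ : A₂ ⟨p + xt, hξ⟩ ∈ (A₂†).domain := hAξ ▸ hxx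
    have hAAξ : A₂† ⟨A₂ ⟨p + xt, hξ⟩, hξξ⟩ = A₂† ⟨A₂ ⟨x, hx₂⟩, hxx⟩ :=
      congrArg (A₂†) (Subtype.ext hAξ)
    exact ⟨hξ, hξξ, hAξ, hAAξ, by rw [hAAξ]; simp⟩
  refine ⟨⟨?_, ?_⟩, ⟨?_, ?_⟩, hattained⟩
  · obtain ⟨hξ, hξξ, -, -, h⟩ := hattained
    exact ⟨p + xt, hξ, hξξ, h.symm⟩
  · rintro r ⟨ξ, hξ, hξξ, rfl⟩
    have hsub : A₂ (⟨x, hx₂⟩ - ⟨ξ, hξ⟩) = A₂ ⟨x, hx₂⟩ - A₂ ⟨ξ, hξ⟩ := LinearPMap.map_sub _ _ _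
    have hmem : A₂ (⟨x, hx₂⟩ - ⟨ξ, hξ⟩) ∈ (A₂†).domain := hsub ▸ sub_mem hxx hξξ
    have hAA : A₂† ⟨A₂ (⟨x, hx₂⟩ - ⟨ξ, hξ⟩), hmem⟩
        = A₂† ⟨A₂ ⟨x, hx₂⟩, hxx⟩ - A₂† ⟨A₂ ⟨ξ, hξ⟩, hξξ⟩ := by
      rw [← LinearPMap.map_sub]
      exact congrArg (A₂†) (Subtype.ext hsub)
    have h1 := inner_le_of_mem_pRan_adjoint hdense₂ hclosed₂ hc₂pos.le hc₂ hc₂adj heA₂s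
      (⟨x, hx₂⟩ - ⟨ξ, hξ⟩) hmem
    rw [hAA, norm_sub_rev, AddSubgroupClass.coe_sub] at h1
    have h2 := real_inner_le_norm p (ξ - xt)
    have h3 : ‖p‖ * ‖p‖ = ⟪p, x - ξ⟫ + ⟪p, ξ - xt⟫ := by
      rw [← inner_add_right, sub_add_sub_cancel, hpinner p heA₂s, real_inner_self_eq_norm_mul_norm]
    refine pow_le_pow_left₀ (norm_nonneg p) ?_ 2
    rcases (norm_nonneg p).eq_or_lt with h0 | hpos
    · rw [← h0]
      positivity
    · refine le_of_mul_le_mul_left ?_ hpos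
      rw [h3, mul_add]
      exact add_le_add h1 h2
  · obtain ⟨φ, hφ, hφφ, hq⟩ := exists_adjoint_apply_apply_eq hdense₂ hrange₂ heA₂s
    refine ⟨φ, hφ, hφφ, ?_⟩
    rw [hvalue φ hφ hφφ, hq, sub_self, norm_zero]
    ring
  · rintro r ⟨φ, hφ, hφφ, rfl⟩
    rw [hvalue φ hφ hφφ]
    exact sub_le_self _ (sq_nonneg _)
end
end

section
/- In the first order setting, let x ∈ D₂ be the exact solution of A₂x = f, A₁*x = g, πx = k, let x̃ ∈ H₂ be arbitrary, and set e := x − x̃ and e_{A₂*} := π_{R(A₂*)}e. Then ‖e_{A₂*}‖²_{H₂} equals the infimum over t ∈ (0,∞) and ξ ∈ D(A₂) of the quadratic functional F(ξ, t) := (1 + t⁻¹)c₂²‖A₂ξ − f‖²_{H₃} + (1 + t)‖ξ − x̃‖²_{H₂}; in particular for every t > 0 and ξ ∈ D(A₂) one has ‖e_{A₂*}‖²_{H₂} ≤ F(ξ, t), and for ξ̂ := e_{A₂*} + x̃ the values F(ξ̂, t) = (1 + t)‖e_{A₂*}‖²_{H₂} converge to ‖e_{A₂*}‖²_{H₂}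 as t → 0. -/
open Submodule LinearPMap RealInnerProductSpace

noncomputable section

variable {H₁ H₂ H₃ : Type*}
  [NormedAddCommGroup H₁] [InnerProductSpace ℝ H₁] [CompleteSpace H₁]
  [NormedAddCommGroup H₂] [InnerProductSpace ℝ H₂] [CompleteSpace H₂]
  [NormedAddCommGroup H₃] [InnerProductSpace ℝ H₃] [CompleteSpace H₃]

section Kernel

variable {E F : Type*} [NormedAddCommGroup E] [InnerProductSpace ℝ E]
  [NormedAddCommGroup F] [InnerProductSpace ℝ F]

theorem mem_pKer_iff {A : E →ₗ.[ℝ] F} {z : E} :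
    z ∈ pKer A ↔ ∃ hz : z ∈ A.domain, A ⟨z, hz⟩ = 0 := by
  constructor
  · rintro ⟨y, hy, rfl⟩
    exact ⟨y.2, hy⟩
  · rintro ⟨hz, h⟩
    exact ⟨⟨z, hz⟩, h, rfl⟩

/-- The kernel of a densely defined closed operator is the orthogonal complement of the range of
its adjoint. -/
theorem orthogonal_pRan_adjoint [CompleteSpace E] [CompleteSpace F] {A : E →ₗ.[ℝ] F}
    (hdense : Dense (A.domain : Set E)) (hclosed : A.IsClosed) :
    (pRan (A†))ᗮ = pKer A := by
  apply le_antisymm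
  · intro z hz
    let G : Submodule ℝ (WithLp 2 (E × F)) :=
      A.graph.comap (WithLp.linearEquiv 2 ℝ (E × F)).toLinearMap
    have hG : IsClosed (G : Set (WithLp 2 (E × F))) :=
      IsClosed.preimage (WithLp.prod_continuous_ofLp 2 E F) hclosed
    have : CompleteSpace G := hG.isComplete.completeSpace_coe
    have hmem : WithLp.toLp 2 (z, (0 : F)) ∈ Gᗮᗮ := by
      rw [Submodule.mem_orthogonal]
      intro p hp
      have horth (y : A.domain) : ⟪p.fst, (y : E)⟫ + ⟪p.snd, A y⟫ = 0 := by
        have h := Submodule.inner_left_of_mem_orthogonal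
          (u := WithLp.toLp 2 ((y : E), A y)) (A.mem_graph y) hp
        simpa [WithLp.prod_inner_apply] using h
      have hform (y : A.domain) : ⟪-p.fst, (y : E)⟫ = ⟪p.snd, A y⟫ := by
        rw [inner_neg_left]
        linarith [horth y]
      have hdom : p.snd ∈ (A†).domain := mem_adjoint_domain_of_exists _ ⟨_, hform⟩
      have hval : A† ⟨p.snd, hdom⟩ = -p.fst := adjoint_apply_eq hdense _ hform
      have hzero := (Submodule.mem_orthogonal _ _).1 hz _
        (LinearMap.mem_range_self (A†).toFun ⟨p.snd, hdom⟩)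
      change ⟪A† ⟨p.snd, hdom⟩, z⟫ = 0 at hzero
      rw [hval, inner_neg_left, neg_eq_zero] at hzero
      simpa [WithLp.prod_inner_apply] using hzero
    rw [Submodule.orthogonal_orthogonal] at hmem
    obtain ⟨y, hy, hAy⟩ := (A.mem_graph_iff).1 (show (z, (0 : F)) ∈ A.graph from hmem)
    simp only at hy hAy
    subst hy
    exact mem_pKer_iff.2 ⟨y.2, hAy⟩
  · intro z hz
    obtain ⟨hzd, hAz⟩ := mem_pKer_iff.1 hz
    rw [Submodule.mem_orthogonal]
    rintro _ ⟨w, rfl⟩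
    have h := adjoint_isFormalAdjoint hdense w ⟨z, hzd⟩
    rw [hAz, inner_zero_right] at h
    exact h

end Kernel

theorem add_sq_le_weighted {a b t : ℝ} (ht : 0 < t) :
    (a + b) ^ 2 ≤ (1 + t⁻¹) * a ^ 2 + (1 + t) * b ^ 2 := by
  have h : (1 + t⁻¹) * a ^ 2 + (1 + t) * b ^ 2 - (a + b) ^ 2 = t⁻¹ * (a - t * b) ^ 2 := by
    field_simp
    ring
  have : 0 ≤ t⁻¹ * (a - t * b) ^ 2 := by positivity
  linarith

/-- Quadratic-functional form of the upper bound for the `R(A₂†)` part of the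
error: with `e_{A₂†} = π_{R(A₂†)} (x - xt)` and
`F(ξ, t) = (1 + t⁻¹) c₂² ‖A₂ξ - f‖² + (1 + t) ‖ξ - xt‖²`, the quantity `‖e_{A₂†}‖²` is the
infimum of `F(ξ, t)` over `t ∈ (0,∞)` and `ξ ∈ D(A₂)`; in particular `‖e_{A₂†}‖² ≤ F(ξ, t)`
for all such `t, ξ`, and for `ξ̂ = e_{A₂†} + xt` the values `F(ξ̂, t) = (1 + t)‖e_{A₂†}‖²`
converge to `‖e_{A₂†}‖²` as `t → 0`. -/
theorem statement19 (A₁ : H₁ →ₗ.[ℝ] H₂) (A₂ : H₂ →ₗ.[ℝ] H₃)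
    (hdense₁ : Dense (A₁.domain : Set H₁)) (hdense₂ : Dense (A₂.domain : Set H₂))
    (hclosed₁ : A₁.IsClosed) (hclosed₂ : A₂.IsClosed)
    (hcomplex : pRan A₁ ≤ pKer A₂)
    (hrange₁ : IsClosed (pRan A₁ : Set H₂)) (hrange₂ : IsClosed (pRan A₂ : Set H₃))
    (f : H₃) (g : H₁) (k : H₂)
    (hf : f ∈ pRan A₂) (hg : g ∈ pRan (A₁†)) (hk : k ∈ pKer A₂ ⊓ pKer (A₁†))
    -- `x ∈ D₂` is the exact solution: `A₂ x = f`, `A₁† x = g`, `π x = k`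
    (x : H₂) (hx₂ : x ∈ A₂.domain) (hx₁ : x ∈ (A₁†).domain)
    (hxf : A₂ ⟨x, hx₂⟩ = f) (hxg : A₁† ⟨x, hx₁⟩ = g)
    (hxk : x - k ∈ (pKer A₂ ⊓ pKer (A₁†))ᗮ)
    -- `xt` is an arbitrary (possibly nonconforming) approximation
    (xt : H₂)
    -- `c₂` is the Friedrichs/Poincaré constant for `A₂` (and for `A₂†`)
    (c₂ : ℝ) (hc₂pos : 0 < c₂)
    (hc₂ : ∀ v : A₂.domain, (v : H₂) ∈ (pKer A₂)ᗮ → ‖(v : H₂)‖ ≤ c₂ * ‖A₂ v‖)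
    (hc₂adj : ∀ w : (A₂†).domain, (w : H₃) ∈ (pKer (A₂†))ᗮ → ‖(w : H₃)‖ ≤ c₂ * ‖A₂† w‖)
    -- `eA₂s = π_{R(A₂†)} (x - xt)`
    (eA₂s : H₂) (heA₂s : eA₂s ∈ pRan (A₂†))
    (heA₂sperp : (x - xt) - eA₂s ∈ (pRan (A₂†))ᗮ) :
    -- `‖e_{A₂†}‖²` is the infimum of the quadratic functional
    IsGLB {r : ℝ | ∃ t ∈ Set.Ioi (0 : ℝ), ∃ ξ : A₂.domain,
      r = (1 + t⁻¹) * c₂ ^ 2 * ‖A₂ ξ - f‖ ^ 2 + (1 + t) * ‖(ξ : H₂) - xt‖ ^ 2} (‖eA₂s‖ ^ 2)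
    -- in particular it is a guaranteed lower bound of the functional
    ∧ (∀ t ∈ Set.Ioi (0 : ℝ), ∀ ξ : A₂.domain,
        ‖eA₂s‖ ^ 2 ≤ (1 + t⁻¹) * c₂ ^ 2 * ‖A₂ ξ - f‖ ^ 2 + (1 + t) * ‖(ξ : H₂) - xt‖ ^ 2)
    -- and for `ξ̂ = e_{A₂†} + xt` the functional degenerates to `(1 + t)‖e_{A₂†}‖²`,
    -- which converges to `‖e_{A₂†}‖²` as `t → 0⁺`
    ∧ (∃ hξ : eA₂s + xt ∈ A₂.domain,
        ∀ t ∈ Set.Ioi (0 : ℝ),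
          (1 + t⁻¹) * c₂ ^ 2 * ‖A₂ ⟨eA₂s + xt, hξ⟩ - f‖ ^ 2
            + (1 + t) * ‖(eA₂s + xt) - xt‖ ^ 2 = (1 + t) * ‖eA₂s‖ ^ 2)
    ∧ Filter.Tendsto (fun t : ℝ => (1 + t) * ‖eA₂s‖ ^ 2)
        (nhdsWithin 0 (Set.Ioi 0)) (nhds (‖eA₂s‖ ^ 2)) := by
  have hker : (pRan (A₂†))ᗮ = pKer A₂ := orthogonal_pRan_adjoint hdense₂ hclosed₂
  have hlim : Filter.Tendsto (fun t : ℝ => (1 + t) * ‖eA₂s‖ ^ 2)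
      (nhdsWithin 0 (Set.Ioi 0)) (nhds (‖eA₂s‖ ^ 2)) := by
    have h : Continuous fun t : ℝ => (1 + t) * ‖eA₂s‖ ^ 2 := by fun_prop
    simpa using (h.tendsto 0).mono_left nhdsWithin_le_nhds
  have hmin : ∃ hξ : eA₂s + xt ∈ A₂.domain,
      ∀ t ∈ Set.Ioi (0 : ℝ),
        (1 + t⁻¹) * c₂ ^ 2 * ‖A₂ ⟨eA₂s + xt, hξ⟩ - f‖ ^ 2
          + (1 + t) * ‖(eA₂s + xt) - xt‖ ^ 2 = (1 + t) * ‖eA₂s‖ ^ 2 := by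
    obtain ⟨hzd, hAz⟩ := mem_pKer_iff.1 (hker ▸ heA₂sperp)
    have hsub : eA₂s + xt = x - ((x - xt) - eA₂s) := by abel
    have hξ : eA₂s + xt ∈ A₂.domain := hsub ▸ A₂.domain.sub_mem hx₂ hzd
    have hA : A₂ ⟨eA₂s + xt, hξ⟩ = f := by
      have h : (⟨eA₂s + xt, hξ⟩ : A₂.domain) = ⟨x, hx₂⟩ - ⟨_, hzd⟩ := Subtype.ext hsub
      rw [h, A₂.map_sub, hAz, hxf, sub_zero]
    exact ⟨hξ, fun t _ => by simp [hA]⟩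
  have hle : ∀ t ∈ Set.Ioi (0 : ℝ), ∀ ξ : A₂.domain,
      ‖eA₂s‖ ^ 2 ≤ (1 + t⁻¹) * c₂ ^ 2 * ‖A₂ ξ - f‖ ^ 2 + (1 + t) * ‖(ξ : H₂) - xt‖ ^ 2 := by
    intro t ht ξ
    obtain ⟨n, hn, w, hw, hnw⟩ :=
      (pRan (A₂†))ᗮ.exists_add_mem_mem_orthogonal (x - (ξ : H₂))
    obtain ⟨hnd, hAn⟩ := mem_pKer_iff.1 (hker ▸ hn)
    have hwsub : w = (x - (ξ : H₂)) - n := by rw [hnw]; abel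
    have hwd : w ∈ A₂.domain :=
      hwsub ▸ A₂.domain.sub_mem (A₂.domain.sub_mem hx₂ ξ.2) hnd
    have hAw : A₂ ⟨w, hwd⟩ = f - A₂ ξ := by
      have h : (⟨w, hwd⟩ : A₂.domain) = (⟨x, hx₂⟩ - ξ) - ⟨n, hnd⟩ := Subtype.ext hwsub
      rw [h, A₂.map_sub, A₂.map_sub, hAn, hxf, sub_zero]
    have hwle : ‖w‖ ≤ c₂ * ‖A₂ ξ - f‖ := by
      have h := hc₂ ⟨w, hwd⟩ (hker ▸ hw)
      rwa [hAw, norm_sub_rev] at h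
    have hen : ⟪eA₂s, n⟫ = 0 := (Submodule.mem_orthogonal _ _).1 hn _ heA₂s
    have hee : ⟪eA₂s, (x - xt) - eA₂s⟫ = 0 :=
      (Submodule.mem_orthogonal _ _).1 heA₂sperp _ heA₂s
    have hinner : ‖eA₂s‖ ^ 2 = ⟪eA₂s, w + ((ξ : H₂) - xt)⟫ := by
      have h : (x - xt) - eA₂s = n + (w + ((ξ : H₂) - xt)) - eA₂s := by
        rw [hwsub]; abel
      rw [h, inner_sub_right, inner_add_right, hen, real_inner_self_eq_norm_sq] at hee
      linarith
    have hnorm : ‖eA₂s‖ ≤ c₂ * ‖A₂ ξ - f‖ + ‖(ξ : H₂) - xt‖ := by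
      have h₁ : ‖eA₂s‖ * ‖eA₂s‖ ≤ ‖eA₂s‖ * ‖w + ((ξ : H₂) - xt)‖ := by
        rw [← sq, hinner]
        exact real_inner_le_norm _ _
      have h₂ : ‖eA₂s‖ ≤ ‖w + ((ξ : H₂) - xt)‖ := by
        rcases (norm_nonneg eA₂s).eq_or_lt with h | h
        · rw [← h]; positivity
        · exact le_of_mul_le_mul_left h₁ h
      linarith [norm_add_le w ((ξ : H₂) - xt)]
    calc ‖eA₂s‖ ^ 2 ≤ (c₂ * ‖A₂ ξ - f‖ + ‖(ξ : H₂) - xt‖) ^ 2 := by gcongr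
      _ ≤ (1 + t⁻¹) * (c₂ * ‖A₂ ξ - f‖) ^ 2 + (1 + t) * ‖(ξ : H₂) - xt‖ ^ 2 :=
        add_sq_le_weighted ht
      _ = _ := by ring
  refine ⟨⟨?_, fun m hm => ?_⟩, hle, hmin, hlim⟩
  · rintro _ ⟨t, ht, ξ, rfl⟩
    exact hle t ht ξ
  · obtain ⟨hξ, hval⟩ := hmin
    refine ge_of_tendsto hlim (eventually_nhdsWithin_of_forall fun t ht => ?_)
    exact hm ⟨t, ht, ⟨_, hξ⟩, (hval t ht).symm⟩
end
end
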